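/- arXiv:1908.09167 — 2 statements merged into one kernel-verified Lean document; each statement's English description precedes it below -/
import Mathlib

section
/- Let N, L be positive integers and let (ρ, M) ∈ M^N. Suppose a finite family of linear input constraints is given by vectors α_l ∈ ℝ^N, scalars β_l ∈ ℝ, and column indices j_l ∈ {1, …, N} for l = 1, …, L, and that: (i) ∑_{i=1}^N α_{l,i} M_{(i, j_l)} ≤ β_l ρ_{j_l} for every l, and (ii) there exists Π̄ ∈ P^N with ∑_{i=1}^N α_{l,i} Π̄_{(i, j_l)} ≤ β_l for every l. Then there exists Π ∈ P^N such that M = Π · diag(ρ) and ∑_{i=1}^N α_{l,i} Π_{(i, j_l)} ≤ β_l for every l = 1, …, L. -/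
/-- The set `P^N` of valid transition probability matrices: nonnegative entries and
each column sums to 1 (`1ᵀ Π = 1ᵀ`). -/
def validTransMatrices (N : ℕ) : Set (Matrix (Fin N) (Fin N) ℝ) :=
  {P | (∀ i j, 0 ≤ P i j) ∧ ∀ j, ∑ i, P i j = 1}

/-- The set `M^N` of pairs `(ρ, M)` with `ρ` nonnegative, `M` nonnegative entrywise,
and `1ᵀ M = ρᵀ` (the `j`-th column of `M` sums to `ρ_j`). -/
def jointSet (N : ℕ) : Set ((Fin N → ℝ) × Matrix (Fin N) (Fin N) ℝ) :=
  {p | (∀ i, 0 ≤ p.1 i) ∧ (∀ i j, 0 ≤ p.2 i j) ∧ ∀ j, ∑ i, p.2 i j = p.1 j}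

/-- Given `(ρ, M) ∈ M^N` and a family of linear input constraints
`∑_i α_{l,i} M_{(i,j_l)} ≤ β_l ρ_{j_l}` which is feasible for some `Π̄ ∈ P^N`
(in the sense `∑_i α_{l,i} Π̄_{(i,j_l)} ≤ β_l`), there exists `Π ∈ P^N` with
`M = Π · diag(ρ)` satisfying `∑_i α_{l,i} Π_{(i,j_l)} ≤ β_l` for every `l`. -/
theorem reconstruction_with_linear_constraints
    (N L : ℕ) (hN : 0 < N) (hL : 0 < L)
    (ρ : Fin N → ℝ) (M : Matrix (Fin N) (Fin N) ℝ)
    (hmem : (ρ, M) ∈ jointSet N)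
    (α : Fin L → Fin N → ℝ) (β : Fin L → ℝ) (jl : Fin L → Fin N)
    (hM : ∀ l, ∑ i, α l i * M i (jl l) ≤ β l * ρ (jl l))
    (hfeas : ∃ Pbar ∈ validTransMatrices N,
        ∀ l, ∑ i, α l i * Pbar i (jl l) ≤ β l) :
    ∃ P ∈ validTransMatrices N,
      M = P * Matrix.diagonal ρ ∧
      ∀ l, ∑ i, α l i * P i (jl l) ≤ β l := by
  obtain ⟨hρ, hM0, hsum⟩ := hmem
  obtain ⟨Q, ⟨hQ0, hQ1⟩, hQ⟩ := hfeas
  dsimp only at hρ hM0 hsum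
  refine ⟨Matrix.of fun i j => if ρ j = 0 then Q i j else M i j / ρ j, ⟨?_, ?_⟩, ?_, ?_⟩
  · intro i j
    rw [Matrix.of_apply]
    split_ifs
    · exact hQ0 i j
    · exact div_nonneg (hM0 i j) (hρ j)
  · intro j
    by_cases h : ρ j = 0
    · simpa [h] using hQ1 j
    · simp [h, ← Finset.sum_div, hsum j]
  · ext i j
    rw [Matrix.mul_diagonal, Matrix.of_apply]
    split_ifs with h
    · have hcol := (Finset.sum_eq_zero_iff_of_nonneg fun k _ => hM0 k j).1 ((hsum j).trans h)
      simpa [h] using hcol i (Finset.mem_univ i)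
    · exact (div_mul_cancel₀ _ h).symm
  · intro l
    by_cases h : ρ (jl l) = 0
    · simpa [h] using hQ l
    · have hpos : 0 < ρ (jl l) := lt_of_le_of_ne (hρ _) (Ne.symm h)
      simpa [h, mul_div_assoc, Finset.sum_div] using (div_le_iff₀ hpos).2 (hM l)
end

section
/- Let N, T be positive integers and let ρ̄ be in the probability simplex of ℝ^N. Then the following two sets of pairs consisting of a state trajectory (ρ^0, …, ρ^T) and a matrix trajectory (M^0, …, M^{T-1}) are equal: (1) the set of pairs of the form ((ρ^0, …, ρ^T), (Π^0·diag(ρ^0), …, Π^{T-1}·diag(ρ^{T-1}))) where ρ^0 = ρ̄, each Π^t ∈ P^N, and ρ^{t+1} = Π^t ρ^t for all t; (2) the set of pairs ((ρ^0, …, ρ^T), (M^0, …, M^{T-1})) where ρ^0 = ρ̄, (ρ^t, M^t) ∈ M^N for each t = 0, …, T−1, and ρ^{t+1} = M^t · 1_N for all t. -/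
/-- The probability simplex `S^N`: vectors in `ℝ^N` with nonnegative entries summing to 1. -/
def probSimplex (N : ℕ) : Set (Fin N → ℝ) :=
  {ρ | (∀ i, 0 ≤ ρ i) ∧ ∑ i, ρ i = 1}

theorem mulVec_nonneg_of_mem_validTransMatrices {N : ℕ} {P : Matrix (Fin N) (Fin N) ℝ}
    (hP : P ∈ validTransMatrices N) {ρ : Fin N → ℝ} (hρ : ∀ i, 0 ≤ ρ i) (i : Fin N) :
    0 ≤ P.mulVec ρ i := by
  simp only [Matrix.mulVec, dotProduct]
  exact Finset.sum_nonneg fun j _ => mul_nonneg (hP.1 i j) (hρ j)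

theorem mul_diagonal_mem_jointSet {N : ℕ} {P : Matrix (Fin N) (Fin N) ℝ}
    (hP : P ∈ validTransMatrices N) {ρ : Fin N → ℝ} (hρ : ∀ i, 0 ≤ ρ i) :
    (ρ, P * Matrix.diagonal ρ) ∈ jointSet N := by
  refine ⟨hρ, fun i j => ?_, fun j => ?_⟩
  · simpa only [Matrix.mul_diagonal] using mul_nonneg (hP.1 i j) (hρ j)
  · simp only [Matrix.mul_diagonal, ← Finset.sum_mul, hP.2 j, one_mul]

theorem mul_diagonal_mulVec_one {N : ℕ} (P : Matrix (Fin N) (Fin N) ℝ) (ρ : Fin N → ℝ) :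
    (P * Matrix.diagonal ρ).mulVec (fun _ => (1 : ℝ)) = P.mulVec ρ := by
  ext i
  simp [Matrix.mulVec, dotProduct]

/-- Each column of `M` is divided by its sum; zero columns are replaced by those of the
identity matrix. -/
theorem exists_mul_diagonal_eq_of_mem_jointSet {N : ℕ} {ρ : Fin N → ℝ}
    {M : Matrix (Fin N) (Fin N) ℝ} (h : (ρ, M) ∈ jointSet N) :
    ∃ P ∈ validTransMatrices N, M = P * Matrix.diagonal ρ := by
  obtain ⟨hρ, hM, hsum⟩ := h
  dsimp only at hρ hM hsum
  refine ⟨Matrix.of fun i j =>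
      if ρ j = 0 then (1 : Matrix (Fin N) (Fin N) ℝ) i j else M i j / ρ j,
    ⟨fun i j => ?_, fun j => ?_⟩, ?_⟩
  · rw [Matrix.of_apply]
    split_ifs
    · rw [Matrix.one_apply]
      split_ifs <;> norm_num
    · exact div_nonneg (hM i j) (hρ j)
  · by_cases hj : ρ j = 0
    · simp [hj, Matrix.one_apply]
    · simp [hj, ← Finset.sum_div, hsum j]
  · ext i j
    rw [Matrix.mul_diagonal]
    by_cases hj : ρ j = 0
    · have hcol := (Finset.sum_eq_zero_iff_of_nonneg fun i _ => hM i j).1 ((hsum j).trans hj)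
      simp [hj, hcol i (Finset.mem_univ i)]
    · simp [hj]

/-- The set of pairs of state/matrix trajectories obtained via the change of variables
`M^t = Π^t · diag(ρ^t)` from valid transition matrices equals the set of pairs with
`(ρ^t, M^t) ∈ M^N` and `ρ^{t+1} = M^t · 1_N`. -/
theorem trajectory_pair_sets_eq
    (N T : ℕ) (hN : 0 < N) (hT : 0 < T)
    (ρbar : Fin N → ℝ) (hρbar : ρbar ∈ probSimplex N) :
    {p : (Fin (T + 1) → Fin N → ℝ) × (Fin T → Matrix (Fin N) (Fin N) ℝ) |
        ∃ P : Fin T → Matrix (Fin N) (Fin N) ℝ,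
          p.1 0 = ρbar ∧
          (∀ t, P t ∈ validTransMatrices N) ∧
          (∀ t : Fin T, p.1 t.succ = (P t).mulVec (p.1 t.castSucc)) ∧
          (∀ t : Fin T, p.2 t = P t * Matrix.diagonal (p.1 t.castSucc))} =
      {p : (Fin (T + 1) → Fin N → ℝ) × (Fin T → Matrix (Fin N) (Fin N) ℝ) |
        p.1 0 = ρbar ∧
        (∀ t : Fin T, (p.1 t.castSucc, p.2 t) ∈ jointSet N) ∧
        (∀ t : Fin T, p.1 t.succ = (p.2 t).mulVec (fun _ => (1 : ℝ)))} := by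
  ext p
  constructor
  · rintro ⟨P, h0, hP, hstep, hM⟩
    have hnonneg : ∀ t i, 0 ≤ p.1 t i := fun t => by
      induction t using Fin.induction with
      | zero => exact h0 ▸ hρbar.1
      | succ t ih => exact hstep t ▸ mulVec_nonneg_of_mem_validTransMatrices (hP t) ih
    refine ⟨h0, fun t => ?_, fun t => ?_⟩
    · exact hM t ▸ mul_diagonal_mem_jointSet (hP t) (hnonneg _)
    · rw [hM t, mul_diagonal_mulVec_one, hstep t]
  · rintro ⟨h0, hjoint, hstep⟩
    choose P hP hM using fun t => exists_mul_diagonal_eq_of_mem_jointSet (hjoint t)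
    exact ⟨P, h0, hP, fun t => by rw [hstep t, hM t, mul_diagonal_mulVec_one], hM⟩
end
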